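/- arXiv:1601.03436 — 3 statements merged into one kernel-verified Lean document; each statement's English description precedes it below -/
import Mathlib

section
/- Let R be an associative unital ring and M a left R-module that is projective in σ[M] and semiprime. If N = Ann_M(U) for a uniform submodule U ≤ M, then N is a maximal annihilator submodule (maximal with respect to inclusion among annihilator submodules of M). -/
universe u v

section Defs

variable (R : Type u) [Ring R] (M : Type v) [AddCommGroup M] [Module R M]

/-- The product `K ·_M L` of submodules: the sum of all images `f K` over `f : M → L`. -/
def prodM (K L : Submodule R M) : Submodule R M :=
  ⨆ (f : M →ₗ[R] M) (_ : LinearMap.range f ≤ L), K.map f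

/-- A submodule is fully invariant if it is stable under every endomorphism. -/
def IsFullyInvariant (N : Submodule R M) : Prop :=
  ∀ f : M →ₗ[R] M, N.map f ≤ N

/-- A fully invariant submodule `N` is prime in `M` if `K ·_M L ≤ N` implies `K ≤ N` or
`L ≤ N` for all fully invariant submodules `K, L`. -/
def IsPrimeSubmodule (N : Submodule R M) : Prop :=
  IsFullyInvariant R M N ∧
    ∀ K L : Submodule R M, IsFullyInvariant R M K → IsFullyInvariant R M L →
      prodM R M K L ≤ N → K ≤ N ∨ L ≤ N

/-- A fully invariant submodule `N` is semiprime in `M` if `K ·_M K ≤ N` implies `K ≤ N`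
for every fully invariant submodule `K`. -/
def IsSemiprimeSubmodule (N : Submodule R M) : Prop :=
  IsFullyInvariant R M N ∧
    ∀ K : Submodule R M, IsFullyInvariant R M K → prodM R M K K ≤ N → K ≤ N

/-- `M` is a semiprime module if `⊥` is semiprime in `M`. -/
def IsSemiprimeModule : Prop := IsSemiprimeSubmodule R M ⊥

/-- `M` is a prime module if `⊥` is prime in `M`. -/
def IsPrimeModule : Prop := IsPrimeSubmodule R M ⊥

/-- A minimal prime submodule: prime and minimal among prime submodules. -/
def IsMinimalPrimeSubmodule (P : Submodule R M) : Prop :=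
  IsPrimeSubmodule R M P ∧ ∀ Q : Submodule R M, IsPrimeSubmodule R M Q → Q ≤ P → Q = P

/-- `X` is `M`-generated: a homomorphic image of a direct sum of copies of `M`. -/
def IsMGenerated (X : Type v) [AddCommGroup X] [Module R X] : Prop :=
  ∃ (ι : Type v) (f : (ι →₀ M) →ₗ[R] X), Function.Surjective f

/-- `X` belongs to `σ[M]`: isomorphic to a submodule of an `M`-generated module. -/
def InSigmaM (X : Type v) [AddCommGroup X] [Module R X] : Prop :=
  ∃ (Y : Type v) (_ : AddCommGroup Y) (_ : Module R Y),
    IsMGenerated R M Y ∧ ∃ g : X →ₗ[R] Y, Function.Injective g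

/-- `M` is projective in `σ[M]`. -/
def ProjectiveInSigmaM : Prop :=
  ∀ (A B : Type v) [AddCommGroup A] [Module R A] [AddCommGroup B] [Module R B],
    InSigmaM R M A → InSigmaM R M B →
      ∀ g : A →ₗ[R] B, Function.Surjective g →
        ∀ h : M →ₗ[R] B, ∃ f : M →ₗ[R] A, g ∘ₗ f = h

/-- `N` is essential in `M`. -/
def IsEssentialSub (N : Submodule R M) : Prop :=
  ∀ L : Submodule R M, L ≠ ⊥ → N ⊓ L ≠ ⊥

/-- `M` has finite uniform dimension: no infinite independent family of nonzero submodules. -/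
def HasFinUdim : Prop :=
  ¬ ∃ f : ℕ → Submodule R M, (∀ n, f n ≠ ⊥) ∧
      ∀ n, Disjoint (f n) (⨆ (m) (_ : m ≠ n), f m)

/-- A left annihilator in `M`: an intersection `⋂_{f ∈ X} ker f` with `X ⊆ End_R(M)`. -/
def IsLeftAnnihilatorSub (N : Submodule R M) : Prop :=
  ∃ X : Set (M →ₗ[R] M), N = ⨅ f ∈ X, LinearMap.ker f

/-- ACC on left annihilators. -/
def AccLeftAnnihilators : Prop :=
  ∀ a : ℕ → Submodule R M, (∀ n, IsLeftAnnihilatorSub R M (a n)) → Monotone a →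
    ∃ n, ∀ m, n ≤ m → a m = a n

/-- `M` is a Goldie module: ACC on left annihilators and finite uniform dimension. -/
def IsGoldieModule : Prop := AccLeftAnnihilators R M ∧ HasFinUdim R M

/-- `Ann_M(K) = ⋂ { ker f | f ∈ Hom_R(M, K) }`. -/
def annM (K : Submodule R M) : Submodule R M :=
  ⨅ (f : M →ₗ[R] M) (_ : LinearMap.range f ≤ K), LinearMap.ker f

/-- `N` is an annihilator submodule: `N = Ann_M(K)` for some nonzero submodule `K`. -/
def IsAnnihilatorSub (N : Submodule R M) : Prop :=
  ∃ K : Submodule R M, K ≠ ⊥ ∧ N = annM R M K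

/-- A submodule `U` is uniform: nonzero and every nonzero submodule of `U` is essential in `U`. -/
def IsUniformSub (U : Submodule R M) : Prop :=
  U ≠ ⊥ ∧ ∀ A B : Submodule R M, A ≤ U → B ≤ U → A ≠ ⊥ → B ≠ ⊥ → A ⊓ B ≠ ⊥

/-- A submodule `U` is monoform: nonzero and every nonzero homomorphism `L → U` from a
submodule `L ≤ U` is injective. -/
def IsMonoformSub (U : Submodule R M) : Prop :=
  U ≠ ⊥ ∧ ∀ L : Submodule R M, L ≤ U → ∀ f : L →ₗ[R] U, f ≠ 0 → Function.Injective f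

/-- `M` has enough monoforms: every nonzero submodule contains a monoform submodule. -/
def HasEnoughMonoforms : Prop :=
  ∀ N : Submodule R M, N ≠ ⊥ → ∃ U : Submodule R M, U ≤ N ∧ IsMonoformSub R M U

/-- `M` is weakly compressible. -/
def WeaklyCompressible : Prop :=
  ∀ N : Submodule R M, N ≠ ⊥ → ∃ f : M →ₗ[R] M, LinearMap.range f ≤ N ∧ f ∘ₗ f ≠ 0

/-- `M` is retractable: `Hom_R(M, N) ≠ 0` for every nonzero submodule `N`. -/
def Retractable : Prop :=
  ∀ N : Submodule R M, N ≠ ⊥ → ∃ f : M →ₗ[R] M, LinearMap.range f ≤ N ∧ f ≠ 0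

/-- Powers of a fully invariant submodule: `J^0 = ⊥`, `J^1 = J`, `J^(m+1) = J ·_M J^m`. -/
def fipow (J : Submodule R M) : ℕ → Submodule R M
  | 0 => ⊥
  | 1 => J
  | n + 2 => prodM R M J (fipow J (n + 1))

end Defs

section RingDefs

variable (S : Type*) [Ring S]

/-- A ring is semiprime: no nonzero two-sided ideal squares to zero. -/
def IsSemiprimeRing : Prop :=
  ∀ I : TwoSidedIdeal S, (∀ a ∈ I, ∀ b ∈ I, a * b = 0) → I = ⊥

/-- A ring is prime: `I · J = 0` forces `I = 0` or `J = 0` for two-sided ideals. -/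
def IsPrimeRing : Prop :=
  ∀ I J : TwoSidedIdeal S, (∀ a ∈ I, ∀ b ∈ J, a * b = 0) → I = ⊥ ∨ J = ⊥

/-- A right annihilator subset of `S`: `{ s | X s = 0 }` for some `X ⊆ S`. -/
def IsRightAnnihilatorSet (T : Set S) : Prop :=
  ∃ X : Set S, T = {s : S | ∀ x ∈ X, x * s = 0}

/-- ACC on right annihilators of the ring `S`. -/
def AccRightAnnihilators : Prop :=
  ∀ a : ℕ → Set S, (∀ n, IsRightAnnihilatorSet S (a n)) → (∀ n, a n ⊆ a (n + 1)) →
    ∃ n, ∀ m, n ≤ m → a m = a n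

/-- `S` is a right Goldie ring: ACC on right annihilators and finite uniform dimension
as a right `S`-module. -/
def IsRightGoldieRing : Prop :=
  AccRightAnnihilators S ∧ HasFinUdim Sᵐᵒᵖ S

end RingDefs

section Annihilators

variable {R : Type u} [Ring R] {M : Type v} [AddCommGroup M] [Module R M]

theorem mem_annM {K : Submodule R M} {x : M} :
    x ∈ annM R M K ↔ ∀ f : M →ₗ[R] M, LinearMap.range f ≤ K → f x = 0 := by
  simp [annM, Submodule.mem_iInf]

theorem annM_antitone : Antitone (annM R M) := fun _ _ h _ hx =>
  mem_annM.2 fun f hf => mem_annM.1 hx f (hf.trans h)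

theorem isFullyInvariant_annM (K : Submodule R M) : IsFullyInvariant R M (annM R M K) := by
  rintro f _ ⟨x, hx, rfl⟩
  refine mem_annM.2 fun g hg => mem_annM.1 hx (g ∘ₗ f) ?_
  exact (LinearMap.range_comp_le_range f g).trans hg

theorem map_le_prodM {K L : Submodule R M} {f : M →ₗ[R] M} (hf : LinearMap.range f ≤ L) :
    K.map f ≤ prodM R M K L :=
  le_iSup₂_of_le f hf le_rfl

theorem prodM_le_right (K L : Submodule R M) : prodM R M K L ≤ L :=
  iSup₂_le fun _ hf => LinearMap.map_le_range.trans hf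

theorem prodM_eq_bot_iff {K L : Submodule R M} : prodM R M K L = ⊥ ↔ K ≤ annM R M L := by
  constructor
  · intro h x hx
    refine mem_annM.2 fun f hf => ?_
    have := map_le_prodM (K := K) hf (Submodule.mem_map_of_mem hx)
    rwa [h, Submodule.mem_bot] at this
  · intro h
    refine eq_bot_iff.2 (iSup₂_le fun f hf => ?_)
    rintro _ ⟨x, hx, rfl⟩
    exact (Submodule.mem_bot R).2 (mem_annM.1 (h hx) f hf)

theorem isFullyInvariant_prodM_top (K : Submodule R M) :
    IsFullyInvariant R M (prodM R M K ⊤) := by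
  intro f
  simp only [prodM, Submodule.map_iSup]
  refine iSup₂_le fun g _ => ?_
  rw [← Submodule.map_comp]
  exact map_le_prodM le_top

theorem isMGenerated_finsupp (ι : Type v) : IsMGenerated R M (ι →₀ M) :=
  ⟨ι, LinearMap.id, Function.surjective_id⟩

theorem isMGenerated_self : IsMGenerated R M M :=
  ⟨PUnit, Finsupp.lapply PUnit.unit, fun x => ⟨Finsupp.single PUnit.unit x, by simp⟩⟩

/-- When `M` is projective in `σ[M]`, a map `M → K ·_M L` factors through a direct sum of
copies of `K`, so it kills the annihilator of `K`. -/
theorem annM_le_annM_prodM (hproj : ProjectiveInSigmaM R M) (K L : Submodule R M) :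
    annM R M K ≤ annM R M (prodM R M K L) := by
  intro z hz
  refine mem_annM.2 fun f hf => ?_
  let ι := {g : M →ₗ[R] M // LinearMap.range g ≤ L}
  let p : (ι →₀ K) →ₗ[R] M := Finsupp.lsum ℕ fun i : ι => i.1 ∘ₗ K.subtype
  have hp : prodM R M K L ≤ LinearMap.range p := by
    refine iSup₂_le fun g hg => ?_
    rintro _ ⟨x, hx, rfl⟩
    exact ⟨Finsupp.single ⟨g, hg⟩ ⟨x, hx⟩, by simp [p]⟩
  obtain ⟨l, hl⟩ := hproj (ι →₀ K) (LinearMap.range p)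
    ⟨ι →₀ M, inferInstance, inferInstance, isMGenerated_finsupp ι,
      Finsupp.mapRange.linearMap K.subtype,
      Finsupp.mapRange_injective _ (map_zero _) K.injective_subtype⟩
    ⟨M, inferInstance, inferInstance, isMGenerated_self, Submodule.subtype _,
      Submodule.injective_subtype _⟩
    p.rangeRestrict p.surjective_rangeRestrict
    (f.codRestrict _ fun x => hp (hf ⟨x, rfl⟩))
  have hlz : l z = 0 := by
    ext i
    refine mem_annM.1 hz (K.subtype ∘ₗ Finsupp.lapply i ∘ₗ l) ?_
    exact (LinearMap.range_comp_le_range _ _).trans K.range_subtype.le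
  have h := congrArg Subtype.val (LinearMap.congr_fun hl z)
  simpa [hlz] using h.symm

theorem eq_bot_of_le_annM_self (hproj : ProjectiveInSigmaM R M) (hsemi : IsSemiprimeModule R M)
    {K : Submodule R M} (hK : K ≤ annM R M K) : K = ⊥ := by
  have hJ : prodM R M K ⊤ ≤ annM R M (prodM R M K ⊤) := iSup₂_le fun f _ =>
    (Submodule.map_mono (hK.trans (annM_le_annM_prodM hproj K ⊤))).trans
      (isFullyInvariant_annM _ f)
  have hle : K ≤ prodM R M K ⊤ := by
    simpa using map_le_prodM (K := K) (f := LinearMap.id) (L := ⊤) le_top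
  exact eq_bot_iff.2
    (hle.trans (hsemi.2 _ (isFullyInvariant_prodM_top K) (prodM_eq_bot_iff.2 hJ).le))

theorem inf_annM_eq_bot (hproj : ProjectiveInSigmaM R M) (hsemi : IsSemiprimeModule R M)
    (K : Submodule R M) : K ⊓ annM R M K = ⊥ :=
  eq_bot_of_le_annM_self hproj hsemi (inf_le_right.trans (annM_antitone inf_le_left))

theorem le_annM_annM (hproj : ProjectiveInSigmaM R M) (hsemi : IsSemiprimeModule R M)
    (K : Submodule R M) : K ≤ annM R M (annM R M K) :=
  prodM_eq_bot_iff.1 (eq_bot_of_le_annM_self hproj hsemi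
    ((prodM_le_right _ _).trans (annM_le_annM_prodM hproj _ _)))

theorem inf_ne_bot_of_not_le_annM {K U : Submodule R M} (hK : IsFullyInvariant R M K)
    (h : ¬ K ≤ annM R M U) : U ⊓ K ≠ ⊥ := by
  intro hbot
  refine h fun x hx => mem_annM.2 fun f hf => ?_
  have : f x ∈ U ⊓ K := ⟨hf ⟨x, rfl⟩, hK f (Submodule.mem_map_of_mem hx)⟩
  rwa [hbot, Submodule.mem_bot] at this

theorem IsUniformSub.annM_le_of_ne_bot (hproj : ProjectiveInSigmaM R M)
    (hsemi : IsSemiprimeModule R M) {U V : Submodule R M} (hU : IsUniformSub R M U)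
    (hVU : V ≤ U) (hV : V ≠ ⊥) : annM R M V ≤ annM R M U := by
  by_contra h
  have hne := inf_ne_bot_of_not_le_annM (isFullyInvariant_annM V) h
  refine hU.2 V (U ⊓ annM R M V) hVU inf_le_left hV hne (eq_bot_iff.2 ?_)
  exact (inf_le_inf_left V inf_le_right).trans (inf_annM_eq_bot hproj hsemi V).le

end Annihilators

/-- For `M` projective in `σ[M]` and semiprime: if `N = Ann_M(U)` with `U`
a uniform submodule, then `N` is a maximal annihilator submodule. -/
theorem stmt12 (R : Type u) [Ring R] (M : Type v) [AddCommGroup M] [Module R M]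
    (hproj : ProjectiveInSigmaM R M) (hsemi : IsSemiprimeModule R M)
    (N U : Submodule R M) (hU : IsUniformSub R M U) (hN : N = annM R M U) :
    IsAnnihilatorSub R M N ∧
      ∀ L : Submodule R M, IsAnnihilatorSub R M L → N ≤ L → L = N := by
  refine ⟨⟨U, hU.1, hN⟩, ?_⟩
  rintro _ ⟨K, hK, rfl⟩ hNL
  subst hN
  refine le_antisymm ?_ hNL
  by_contra h
  have hne := inf_ne_bot_of_not_le_annM (isFullyInvariant_annM K) h
  refine hK (eq_bot_of_le_annM_self hproj hsemi ?_)
  calc K ≤ annM R M (annM R M K) := le_annM_annM hproj hsemi K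
    _ ≤ annM R M (U ⊓ annM R M K) := annM_antitone inf_le_right
    _ ≤ annM R M U := hU.annM_le_of_ne_bot hproj hsemi inf_le_left hne
    _ ≤ annM R M K := hNL
end

section
/- Let R be an associative unital ring and M a left R-module that is projective in σ[M] and semiprime with finite uniform dimension. Then: (1) M has only finitely many minimal prime submodules; (2) M has only finitely many annihilator submodules; (3) M satisfies the ascending chain condition on annihilator submodules. -/
universe u v

section Helpers

variable {R : Type u} [Ring R] {M : Type v} [AddCommGroup M] [Module R M]

theorem annM_anti {K L : Submodule R M} (h : K ≤ L) : annM R M L ≤ annM R M K :=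
  fun _ hx => mem_annM.2 fun f hf => mem_annM.1 hx f (hf.trans h)

theorem prodM_le_iff {K L N : Submodule R M} :
    prodM R M K L ≤ N ↔ ∀ f : M →ₗ[R] M, LinearMap.range f ≤ L → K.map f ≤ N := by
  simp [prodM]

theorem prodM_eq_bot_iff_le_annM {K L : Submodule R M} :
    prodM R M K L ≤ ⊥ ↔ K ≤ annM R M L := by
  rw [prodM_le_iff]
  constructor
  · intro h x hx
    exact mem_annM.2 fun f hf => by simpa using h f hf (Submodule.mem_map_of_mem hx)
  · rintro h f hf _ ⟨x, hx, rfl⟩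
    simpa using mem_annM.1 (h hx) f hf

theorem prodM_mono {K K' L L' : Submodule R M} (hK : K ≤ K') (hL : L ≤ L') :
    prodM R M K L ≤ prodM R M K' L' :=
  prodM_le_iff.2 fun f hf =>
    (Submodule.map_mono hK).trans (prodM_le_iff.1 le_rfl f (hf.trans hL))

namespace IsFullyInvariant

theorem prodM_le_left {K : Submodule R M} (hK : IsFullyInvariant R M K) (L : Submodule R M) :
    prodM R M K L ≤ K :=
  prodM_le_iff.2 fun f _ => hK f

theorem inf {K L : Submodule R M} (hK : IsFullyInvariant R M K)
    (hL : IsFullyInvariant R M L) : IsFullyInvariant R M (K ⊓ L) :=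
  fun f => le_inf ((Submodule.map_mono inf_le_left).trans (hK f))
    ((Submodule.map_mono inf_le_right).trans (hL f))

theorem annM (K : Submodule R M) : IsFullyInvariant R M (annM R M K) := by
  rintro g _ ⟨x, hx, rfl⟩
  exact mem_annM.2 fun f hf =>
    mem_annM.1 hx (f ∘ₗ g) ((LinearMap.range_comp_le_range g f).trans hf)

theorem finset_inf {ι : Type*} {s : Finset ι} {F : ι → Submodule R M}
    (h : ∀ i ∈ s, IsFullyInvariant R M (F i)) : IsFullyInvariant R M (s.inf F) :=
  Finset.inf_induction (p := IsFullyInvariant R M) (fun _ => le_top)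
    (fun _ h₁ _ h₂ => h₁.inf h₂) h

theorem le_annM_of_disjoint {K L : Submodule R M} (hK : IsFullyInvariant R M K)
    (h : Disjoint K L) : K ≤ _root_.annM R M L :=
  prodM_eq_bot_iff_le_annM.1 <|
    (le_inf (hK.prodM_le_left L) (prodM_le_right K L)).trans h.le_bot

theorem disjoint_annM (hsemi : IsSemiprimeModule R M) {K : Submodule R M}
    (hK : IsFullyInvariant R M K) : Disjoint (_root_.annM R M K) K :=
  disjoint_iff_inf_le.2 <| hsemi.2 _ ((annM K).inf hK) <|
    (prodM_mono inf_le_left inf_le_right).trans (prodM_eq_bot_iff_le_annM.2 le_rfl)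

theorem le_annM_iff_disjoint (hsemi : IsSemiprimeModule R M) {K L : Submodule R M}
    (hK : IsFullyInvariant R M K) (hL : IsFullyInvariant R M L) :
    K ≤ _root_.annM R M L ↔ Disjoint K L :=
  ⟨fun h => (hL.disjoint_annM hsemi).mono_left h, hK.le_annM_of_disjoint⟩

end IsFullyInvariant

theorem IsPrimeSubmodule.eq_top_or_exists_le {P : Submodule R M} (hP : IsPrimeSubmodule R M P)
    {ι : Type*} {F : ι → Submodule R M} (s : Finset ι)
    (hF : ∀ i ∈ s, IsFullyInvariant R M (F i)) (h : s.inf F ≤ P) :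
    P = ⊤ ∨ ∃ i ∈ s, F i ≤ P := by
  classical
  induction s using Finset.induction_on with
  | empty => exact Or.inl (top_le_iff.1 (by simpa using h))
  | insert a s _ ih =>
    rw [Finset.inf_insert] at h
    have ha := hF a (Finset.mem_insert_self a s)
    have hs : ∀ i ∈ s, IsFullyInvariant R M (F i) :=
      fun i hi => hF i (Finset.mem_insert_of_mem hi)
    rcases hP.2 _ _ ha (IsFullyInvariant.finset_inf hs)
      ((le_inf (ha.prodM_le_left _) (prodM_le_right _ _)).trans h) with h | h
    · exact Or.inr ⟨a, Finset.mem_insert_self a s, h⟩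
    · exact (ih hs h).imp_right fun ⟨i, hi, h⟩ => ⟨i, Finset.mem_insert_of_mem hi, h⟩

/-- The map from a direct sum of copies of `K`, indexed by the endomorphisms of `M`, whose
component at `g` is the restriction of `g` to `K`. -/
noncomputable def endSumMap (K : Submodule R M) : ((M →ₗ[R] M) →₀ K) →ₗ[R] M :=
  Finsupp.lsum ℕ fun g : M →ₗ[R] M => g ∘ₗ K.subtype

theorem endSumMap_single (K : Submodule R M) (g : M →ₗ[R] M) (x : K) :
    endSumMap K (Finsupp.single g x) = g x := by
  simp [endSumMap]

theorem le_range_endSumMap (K : Submodule R M) : K ≤ LinearMap.range (endSumMap K) :=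
  fun x hx => ⟨Finsupp.single LinearMap.id ⟨x, hx⟩, by simp [endSumMap_single]⟩

theorem isFullyInvariant_range_endSumMap (K : Submodule R M) :
    IsFullyInvariant R M (LinearMap.range (endSumMap K)) := by
  rintro h _ ⟨_, ⟨a, rfl⟩, rfl⟩
  induction a using Finsupp.induction_linear with
  | zero => simp
  | add a b ha hb => simpa using add_mem ha hb
  | single g x =>
    rw [endSumMap_single]
    exact ⟨Finsupp.single (h ∘ₗ g) x, by simp [endSumMap_single]⟩

theorem inSigmaM_finsupp_submodule (ι : Type v) (K : Submodule R M) : InSigmaM R M (ι →₀ K) :=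
  ⟨ι →₀ M, inferInstance, inferInstance, isMGenerated_finsupp ι,
    Finsupp.mapRange.linearMap K.subtype,
    Finsupp.mapRange_injective _ (map_zero _) K.injective_subtype⟩

theorem inSigmaM_submodule (K : Submodule R M) : InSigmaM R M K :=
  ⟨PUnit →₀ M, inferInstance, inferInstance, isMGenerated_finsupp PUnit,
    Finsupp.lsingle PUnit.unit ∘ₗ K.subtype,
    (Finsupp.single_injective _).comp K.injective_subtype⟩

theorem annM_range_endSumMap (hproj : ProjectiveInSigmaM R M) (K : Submodule R M) :
    annM R M (LinearMap.range (endSumMap K)) = annM R M K := by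
  refine le_antisymm (annM_anti (le_range_endSumMap K)) fun x hx => mem_annM.2 fun f hf => ?_
  obtain ⟨f', hf'⟩ := hproj _ _ (inSigmaM_finsupp_submodule (M →ₗ[R] M) K)
    (inSigmaM_submodule (LinearMap.range (endSumMap K))) (endSumMap K).rangeRestrict
    (endSumMap K).surjective_rangeRestrict (f.codRestrict _ fun y => hf ⟨y, rfl⟩)
  have h0 : f' x = 0 := by
    ext g
    refine mem_annM.1 hx (K.subtype ∘ₗ Finsupp.lapply g ∘ₗ f') ?_
    rintro _ ⟨y, rfl⟩
    exact (f' y g).2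
  have h1 := congrArg Subtype.val (LinearMap.congr_fun hf' x)
  simpa [h0] using h1.symm

/-- A nonzero fully invariant submodule in which any two nonzero fully invariant submodules
of `M` intersect nontrivially. -/
def IsFIUniform (U : Submodule R M) : Prop :=
  IsFullyInvariant R M U ∧ U ≠ ⊥ ∧
    ∀ A B : Submodule R M, IsFullyInvariant R M A → IsFullyInvariant R M B →
      A ≤ U → B ≤ U → Disjoint A B → A = ⊥ ∨ B = ⊥

theorem HasFinUdim.not_pairwise_disjoint (hsemi : IsSemiprimeModule R M)
    (hud : HasFinUdim R M) {f : ℕ → Submodule R M} (hf : ∀ n, IsFullyInvariant R M (f n))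
    (h0 : ∀ n, f n ≠ ⊥) : ¬ Pairwise fun m n => Disjoint (f m) (f n) := fun h =>
  hud ⟨f, h0, fun n => (((hf n).disjoint_annM hsemi).mono_left
    (iSup₂_le fun m hm => (hf m).le_annM_of_disjoint (h hm))).symm⟩

theorem exists_isFIUniform_le (hsemi : IsSemiprimeModule R M) (hud : HasFinUdim R M)
    {K : Submodule R M} (hK : IsFullyInvariant R M K) (hK0 : K ≠ ⊥) :
    ∃ U ≤ K, IsFIUniform U := by
  by_contra! hno
  have split : ∀ L : {L : Submodule R M // IsFullyInvariant R M L ∧ L ≠ ⊥ ∧ L ≤ K},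
      ∃ A B : {L : Submodule R M // IsFullyInvariant R M L ∧ L ≠ ⊥ ∧ L ≤ K},
        A.1 ≤ L.1 ∧ B.1 ≤ L.1 ∧ Disjoint A.1 B.1 := by
    rintro ⟨L, hL, hL0, hLK⟩
    by_contra! h
    refine hno L hLK ⟨hL, hL0, fun A B hA hB hAL hBL hAB => ?_⟩
    by_contra! h0
    exact h ⟨A, hA, h0.1, hAL.trans hLK⟩ ⟨B, hB, h0.2, hBL.trans hLK⟩ hAL hBL hAB
  choose A B hA hB hAB using split
  let s : ℕ → {L : Submodule R M // IsFullyInvariant R M L ∧ L ≠ ⊥ ∧ L ≤ K} :=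
    fun n => B^[n] ⟨K, hK, hK0, le_rfl⟩
  have hs : ∀ n, s (n + 1) = B (s n) := fun n => Function.iterate_succ_apply' B n _
  have hanti : Antitone s := antitone_nat_of_succ_le fun n => (hs n).symm ▸ hB (s n)
  refine hud.not_pairwise_disjoint hsemi (f := fun n => (A (s n)).1)
    (fun n => (A (s n)).2.1) (fun n => (A (s n)).2.2.1) ?_
  refine (pairwise_disjoint_on _).2 fun m n hmn => (hAB (s m)).mono_right ?_
  rw [← hs]
  exact (hA (s n)).trans (hanti hmn)

/-- There are finitely many `IsFIUniform` submodules meeting every nonzero fully invariant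
submodule. -/
theorem exists_finset_isFIUniform (hsemi : IsSemiprimeModule R M) (hud : HasFinUdim R M) :
    ∃ T : Finset (Submodule R M), (∀ U ∈ T, IsFIUniform U) ∧
      ∀ Y, IsFullyInvariant R M Y → (∀ U ∈ T, Disjoint Y U) → Y = ⊥ := by
  obtain ⟨T, hT⟩ := zorn_subset
    {T : Set (Submodule R M) | (∀ U ∈ T, IsFIUniform U) ∧ T.Pairwise Disjoint}
    fun c hc hchain => ⟨⋃₀ c, ⟨fun U ⟨t, ht, hU⟩ => (hc ht).1 U hU,
      (Set.pairwise_sUnion hchain.directedOn).2 fun t ht => (hc ht).2⟩,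
      fun _ => Set.subset_sUnion_of_mem⟩
  have hfin : T.Finite := by
    by_contra hinf
    have : Infinite T := Set.infinite_coe_iff.2 hinf
    let e := Infinite.natEmbedding T
    exact hud.not_pairwise_disjoint hsemi (f := fun n => (e n).1)
      (fun n => (hT.prop.1 _ (e n).2).1) (fun n => (hT.prop.1 _ (e n).2).2.1)
      fun m n hmn => hT.prop.2 (e m).2 (e n).2 fun h => hmn (e.injective (Subtype.ext h))
  refine ⟨hfin.toFinset, fun U hU => hT.prop.1 U (hfin.mem_toFinset.1 hU), fun Y hY hd => ?_⟩
  by_contra hY0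
  obtain ⟨V, hVY, hV⟩ := exists_isFIUniform_le hsemi hud hY hY0
  have hVd : ∀ U ∈ T, Disjoint V U := fun U hU =>
    (hd U (hfin.mem_toFinset.2 hU)).mono_left hVY
  have hVT : V ∈ T := hT.le_of_ge (y := insert V T)
    ⟨Set.forall_mem_insert.2 ⟨hV, hT.prop.1⟩,
      Set.pairwise_insert_of_symm.2
        ⟨hT.prop.2, fun U hU _ => hVd U hU⟩⟩
    (Set.subset_insert V T) (Set.mem_insert V T)
  exact hV.2.1 (disjoint_self.1 (hVd V hVT))

theorem IsFIUniform.isPrimeSubmodule_annM (hsemi : IsSemiprimeModule R M)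
    {U : Submodule R M} (hU : IsFIUniform U) : IsPrimeSubmodule R M (annM R M U) := by
  refine ⟨IsFullyInvariant.annM U, fun K L hK hL h => ?_⟩
  rw [hK.le_annM_iff_disjoint hsemi hU.1, hL.le_annM_iff_disjoint hsemi hU.1,
    disjoint_iff, disjoint_iff]
  have hKU := hK.inf hU.1
  have hLU := hL.inf hU.1
  refine hU.2.2 _ _ hKU hLU inf_le_right inf_le_right (disjoint_iff_inf_le.2 ?_)
  refine hsemi.2 _ (hKU.inf hLU) ((le_inf ?_ ?_).trans (hU.1.disjoint_annM hsemi).le_bot)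
  · exact (prodM_mono (inf_le_left.trans inf_le_left) (inf_le_right.trans inf_le_left)).trans h
  · exact (prodM_le_right _ _).trans (inf_le_left.trans inf_le_right)

theorem annM_le_annM_of_disjoint_imp (hsemi : IsSemiprimeModule R M)
    {T : Finset (Submodule R M)} (hT : ∀ U ∈ T, IsFIUniform U)
    (hmeet : ∀ Y, IsFullyInvariant R M Y → (∀ U ∈ T, Disjoint Y U) → Y = ⊥)
    {K L : Submodule R M} (hK : IsFullyInvariant R M K) (hL : IsFullyInvariant R M L)
    (h : ∀ U ∈ T, Disjoint K U → Disjoint L U) : annM R M K ≤ annM R M L := by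
  have hX := IsFullyInvariant.annM K
  refine hX.le_annM_of_disjoint (disjoint_iff.2 (hmeet _ (hX.inf hL) fun U hU => ?_))
  have hd : Disjoint (annM R M K ⊓ L ⊓ U) (K ⊓ U) :=
    (hK.disjoint_annM hsemi).mono (inf_le_left.trans inf_le_left) inf_le_left
  rcases (hT U hU).2.2 _ _ ((hX.inf hL).inf (hT U hU).1) (hK.inf (hT U hU).1)
    inf_le_right inf_le_right hd with h0 | h0
  · exact disjoint_iff.2 h0
  · exact (h U hU (disjoint_iff.2 h0)).mono_left inf_le_right

theorem finite_isMinimalPrimeSubmodule (hsemi : IsSemiprimeModule R M)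
    (hud : HasFinUdim R M) : {P : Submodule R M | IsMinimalPrimeSubmodule R M P}.Finite := by
  obtain ⟨T, hT, hmeet⟩ := exists_finset_isFIUniform hsemi hud
  refine ((T.finite_toSet.image (annM R M)).insert ⊤).subset fun P hP => ?_
  have hinf : T.inf (annM R M) ≤ P := by
    refine (hmeet _ (IsFullyInvariant.finset_inf fun U _ => IsFullyInvariant.annM U)
      fun U hU => ?_).le.trans bot_le
    exact ((hT U hU).1.disjoint_annM hsemi).mono_left (Finset.inf_le hU)
  rcases hP.1.eq_top_or_exists_le T (fun U _ => IsFullyInvariant.annM U) hinf with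
    h | ⟨U, hU, h⟩
  · exact Or.inl h
  · exact Or.inr ⟨U, hU, hP.2 _ ((hT U hU).isPrimeSubmodule_annM hsemi) h⟩

theorem finite_isAnnihilatorSub (hproj : ProjectiveInSigmaM R M)
    (hsemi : IsSemiprimeModule R M) (hud : HasFinUdim R M) :
    {N : Submodule R M | IsAnnihilatorSub R M N}.Finite := by
  classical
  obtain ⟨T, hT, hmeet⟩ := exists_finset_isFIUniform hsemi hud
  have hfin : (annM R M '' {K | IsFullyInvariant R M K}).Finite := by
    refine Set.Finite.of_finite_fibers (f := fun N => T.filter fun U => U ≤ N)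
      (T.powerset.finite_toSet.subset ?_) ?_
    · rintro _ ⟨N, _, rfl⟩
      exact Finset.mem_coe.2 (Finset.mem_powerset.2 (Finset.filter_subset _ _))
    · rintro S -
      refine Set.Subsingleton.finite ?_
      rintro _ ⟨⟨K, hK, rfl⟩, hKS⟩ _ ⟨⟨L, hL, rfl⟩, hLS⟩
      have key : ∀ U ∈ T, (Disjoint K U ↔ Disjoint L U) := by
        intro U hU
        have := Finset.ext_iff.1 (hKS.trans hLS.symm) U
        simpa [hU, (hT U hU).1.le_annM_iff_disjoint hsemi hK,
          (hT U hU).1.le_annM_iff_disjoint hsemi hL, disjoint_comm] using this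
      exact le_antisymm
        (annM_le_annM_of_disjoint_imp hsemi hT hmeet hK hL fun U hU => (key U hU).1)
        (annM_le_annM_of_disjoint_imp hsemi hT hmeet hL hK fun U hU => (key U hU).2)
  refine hfin.subset ?_
  rintro _ ⟨K, _, rfl⟩
  exact ⟨_, isFullyInvariant_range_endSumMap K, annM_range_endSumMap hproj K⟩

theorem Monotone.exists_forall_ge_eq_of_finite {α : Type*} [PartialOrder α] {a : ℕ → α}
    (ha : Monotone a) {s : Set α} (hs : s.Finite) (has : ∀ n, a n ∈ s) :
    ∃ n, ∀ m, n ≤ m → a m = a n := by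
  obtain ⟨_, ⟨n, rfl⟩, hmax⟩ := (hs.subset (Set.range_subset_iff.2 has)).exists_maximal
    (Set.range_nonempty a)
  exact ⟨n, fun m hm => le_antisymm (hmax ⟨m, rfl⟩ (ha hm)) (ha hm)⟩

end Helpers

/-- For `M` projective in `σ[M]`, semiprime, with finite uniform dimension:
(1) finitely many minimal prime submodules; (2) finitely many annihilator submodules;
(3) ACC on annihilator submodules. -/
theorem stmt13 (R : Type u) [Ring R] (M : Type v) [AddCommGroup M] [Module R M]
    (hproj : ProjectiveInSigmaM R M) (hsemi : IsSemiprimeModule R M)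
    (hud : HasFinUdim R M) :
    {P : Submodule R M | IsMinimalPrimeSubmodule R M P}.Finite ∧
    {N : Submodule R M | IsAnnihilatorSub R M N}.Finite ∧
    ∀ a : ℕ → Submodule R M, (∀ n, IsAnnihilatorSub R M (a n)) → Monotone a →
      ∃ n, ∀ m, n ≤ m → a m = a n := by
  have hann := finite_isAnnihilatorSub hproj hsemi hud
  exact ⟨finite_isMinimalPrimeSubmodule hsemi hud, hann,
    fun _ ha hmono => hmono.exists_forall_ge_eq_of_finite hann ha⟩
end

section
/- Let R be an associative unital ring and M ≠ 0 a left R-module that is projective in σ[M]. If M is a prime duo module with finite uniform dimension, then M is uniform, i.e., its uniform dimension equals 1 (every nonzero submodule of M is essential in M). -/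
universe u v

/-- A nonzero prime duo module, projective in `σ[M]`, with finite uniform
dimension, is uniform: every nonzero submodule is essential. -/
theorem stmt19 (R : Type u) [Ring R] (M : Type v) [AddCommGroup M] [Module R M]
    [Nontrivial M] (hproj : ProjectiveInSigmaM R M) (hprime : IsPrimeModule R M)
    (hduo : ∀ N : Submodule R M, IsFullyInvariant R M N)
    (hud : HasFinUdim R M) :
    ∀ N : Submodule R M, N ≠ ⊥ → IsEssentialSub R M N := by
  intro N hN L hL h
  have hprod : prodM R M N L ≤ ⊥ :=
    iSup₂_le fun f hf => h ▸ le_inf (hduo N f) (LinearMap.map_le_range.trans hf)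
  rcases hprime.2 N L (hduo N) (hduo L) hprod with h' | h'
  · exact hN (le_bot_iff.mp h')
  · exact hL (le_bot_iff.mp h')
end
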